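/- arXiv:0805.4180 — 2 statements merged into one kernel-verified Lean document; each statement's English description precedes it below -/
import Mathlib

section
/- The number of Baxter permutations of size n equals ∑_{m=0}^{n-1} [C(n+1,m) C(n+1,m+1) C(n+1,m+2)] / [C(n+1,1) C(n+1,2)]. -/
def IsBaxter {n : ℕ} (π : Equiv.Perm (Fin n)) : Prop :=
  ¬ ∃ i j k : Fin n, ∃ hj : (j : ℕ) + 1 < n,
    i < j ∧ j < k ∧
      ((π ⟨(j : ℕ) + 1, hj⟩ < π i ∧ π i < π k ∧ π k < π j) ∨
       (π j < π k ∧ π k < π i ∧ π i < π ⟨(j : ℕ) + 1, hj⟩))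

open Finset

/-! ### Binomial coefficients with an integer lower index -/

/-- The binomial coefficient with an integer lower index, equal to zero when that index is
negative. -/
def intChoose (n : ℕ) (z : ℤ) : ℚ := if 0 ≤ z then (n.choose z.toNat : ℚ) else 0

lemma intChoose_natCast (n k : ℕ) : intChoose n (k : ℤ) = n.choose k := by
  simp [intChoose]

lemma intChoose_of_neg (n : ℕ) {z : ℤ} (h : z < 0) : intChoose n z = 0 := by
  simp [intChoose, not_le.mpr h]

lemma intChoose_zero (n : ℕ) : intChoose n 0 = 1 := by
  simp [intChoose]

lemma intChoose_zero_left {z : ℤ} (hz : z ≠ 0) : intChoose 0 z = 0 := by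
  rcases lt_or_gt_of_ne hz with h | h
  · exact intChoose_of_neg 0 h
  · lift z to ℕ using h.le
    rw [intChoose_natCast, Nat.choose_eq_zero_of_lt (by exact_mod_cast h), Nat.cast_zero]

lemma intChoose_succ (n : ℕ) (z : ℤ) :
    intChoose (n + 1) z = intChoose n z + intChoose n (z - 1) := by
  rcases lt_trichotomy z 0 with h | rfl | h
  · rw [intChoose_of_neg _ h, intChoose_of_neg _ h, intChoose_of_neg _ (by lia), add_zero]
  · rw [intChoose_zero, intChoose_zero, intChoose_of_neg _ (by lia), add_zero]
  · obtain ⟨k, rfl⟩ : ∃ k : ℕ, z = (k + 1 : ℕ) := ⟨(z - 1).toNat, by lia⟩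
    rw [show ((k + 1 : ℕ) : ℤ) - 1 = (k : ℕ) by lia]
    simp only [intChoose_natCast, Nat.choose_succ_succ]
    push_cast
    ring

lemma intChoose_symm (n : ℕ) (z : ℤ) : intChoose n (n - z) = intChoose n z := by
  by_cases h : 0 ≤ z
  · lift z to ℕ using h
    by_cases hn : z ≤ n
    · rw [← Nat.cast_sub hn, intChoose_natCast, intChoose_natCast, Nat.choose_symm hn]
    · rw [intChoose_of_neg _ (by lia), intChoose_natCast, Nat.choose_eq_zero_of_lt (by lia),
        Nat.cast_zero]
  · obtain ⟨k, hk⟩ : ∃ k : ℕ, (n : ℤ) - z = k := ⟨((n : ℤ) - z).toNat, by lia⟩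
    rw [intChoose_of_neg n (by lia : z < 0), hk, intChoose_natCast,
      Nat.choose_eq_zero_of_lt (by lia), Nat.cast_zero]

lemma sum_intChoose (n i : ℕ) (z : ℤ) :
    ∑ a ∈ range i, intChoose (n + a) z = intChoose (n + i) (z + 1) - intChoose n (z + 1) := by
  induction i with
  | zero => simp
  | succ i ih =>
    rw [sum_range_succ, ih, ← add_assoc, intChoose_succ, add_sub_cancel_right]
    ring

lemma succ_mul_intChoose_succ (n k : ℕ) :
    ((k : ℚ) + 1) * intChoose n (k + 1) = (n - k) * intChoose n k := by
  have h1 : intChoose n ((k : ℤ) + 1) = n.choose (k + 1) := by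
    exact_mod_cast intChoose_natCast n (k + 1)
  rw [h1, intChoose_natCast]
  rcases le_or_gt k n with h | h
  · have := Nat.choose_succ_right_eq n k
    rw [← Nat.cast_sub h]
    push_cast [← this, mul_comm]
    exact_mod_cast (by linarith)
  · rw [Nat.choose_eq_zero_of_lt h, Nat.choose_eq_zero_of_lt (by lia)]
    simp

lemma mul_intChoose_eq (n : ℕ) (z : ℤ) (hz : -1 ≤ z) :
    ((z : ℚ) + 1) * intChoose n (z + 1) = (n - z) * intChoose n z := by
  rcases eq_or_lt_of_le hz with rfl | h
  · rw [intChoose_of_neg n (by lia : (-1 : ℤ) < 0)]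
    simp
  · lift z to ℕ using (by lia)
    exact_mod_cast succ_mul_intChoose_succ n z

/-! ### The number of descendants in the generating tree -/

/-- The determinant counting the nodes reached from a node with label `(i, j)` of the Baxter
generating tree by `N` steps of which exactly `k` shorten the first component. -/
def labelDet (N : ℕ) (k : ℤ) (i j : ℕ) : ℚ :=
  Matrix.det !![intChoose (N + i - 1) k, intChoose (N + i - 1) (k - 1),
      intChoose (N + i - 1) (k - 2);
    intChoose N (k + 1), intChoose N k, intChoose N (k - 1);
    intChoose (N + j - 1) (N - k - 2), intChoose (N + j - 1) (N - k - 1),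
      intChoose (N + j - 1) (N - k)]

lemma labelDet_eq_zero_of_neg (N : ℕ) {k : ℤ} (i j : ℕ) (hk : k < 0) :
    labelDet N k i j = 0 := by
  rw [labelDet, Matrix.det_fin_three]
  simp [intChoose_of_neg _ hk, intChoose_of_neg _ (by lia : k - 1 < 0),
    intChoose_of_neg _ (by lia : k - 2 < 0)]

lemma labelDet_eq_zero_of_lt (N : ℕ) {k : ℤ} (i j : ℕ) (hk : N < k) :
    labelDet N k i j = 0 := by
  rw [labelDet, Matrix.det_fin_three]
  simp [intChoose_of_neg _ (by lia : (N : ℤ) - k < 0),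
    intChoose_of_neg _ (by lia : (N : ℤ) - k - 1 < 0),
    intChoose_of_neg _ (by lia : (N : ℤ) - k - 2 < 0)]

lemma labelDet_zero (i j : ℕ) : labelDet 0 0 i j = 1 := by
  rw [labelDet, Matrix.det_fin_three]
  simp [intChoose_zero, intChoose_of_neg, intChoose_zero_left]

lemma sum_labelDet_left (N : ℕ) (k : ℤ) (i j : ℕ) :
    ∑ a ∈ range i, labelDet N (k - 1) (a + 1) (j + 1) =
      Matrix.det !![intChoose (N + i) k, intChoose (N + i) (k - 1), intChoose (N + i) (k - 2);
        intChoose N k, intChoose N (k - 1), intChoose N (k - 2);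
        intChoose (N + j) (N - k - 1), intChoose (N + j) (N - k),
          intChoose (N + j) (N - k + 1)] := by
  have h0 := sum_intChoose N i (k - 1)
  have h1 := sum_intChoose N i (k - 2)
  have h2 := sum_intChoose N i (k - 3)
  rw [show k - 1 + 1 = k by ring] at h0
  rw [show k - 2 + 1 = k - 1 by ring] at h1
  rw [show k - 3 + 1 = k - 2 by ring] at h2
  simp only [labelDet, Matrix.det_fin_three, Matrix.of_apply, Matrix.cons_val, ← add_assoc,
    Nat.add_sub_cancel, sub_add_cancel, sum_add_distrib, sum_sub_distrib, ← sum_mul]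
  rw [show k - 1 - 1 = k - 2 by ring, show k - 1 - 2 = k - 3 by ring,
    show (N : ℤ) - (k - 1) - 2 = N - k - 1 by ring, show (N : ℤ) - (k - 1) - 1 = N - k by ring,
    show (N : ℤ) - (k - 1) = N - k + 1 by ring, h0, h1, h2]
  ring

lemma sum_labelDet_right (N : ℕ) (k : ℤ) (i j : ℕ) :
    ∑ b ∈ range j, labelDet N k (i + 1) (b + 1) =
      Matrix.det !![intChoose (N + i) k, intChoose (N + i) (k - 1), intChoose (N + i) (k - 2);
        intChoose N (k + 1), intChoose N k, intChoose N (k - 1);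
        intChoose (N + j) (N - k - 1), intChoose (N + j) (N - k),
          intChoose (N + j) (N - k + 1)] := by
  have h0 := sum_intChoose N j (N - k - 2)
  have h1 := sum_intChoose N j (N - k - 1)
  have h2 := sum_intChoose N j (N - k)
  rw [show (N : ℤ) - k - 2 + 1 = N - k - 1 by ring] at h0
  rw [show (N : ℤ) - k - 1 + 1 = N - k by ring] at h1
  have e0 := intChoose_symm N (k + 1)
  have e1 := intChoose_symm N k
  have e2 := intChoose_symm N (k - 1)
  rw [show (N : ℤ) - (k + 1) = N - k - 1 by ring] at e0
  rw [show (N : ℤ) - (k - 1) = N - k + 1 by ring] at e2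
  rw [e0] at h0
  rw [e1] at h1
  rw [e2] at h2
  simp only [labelDet, Matrix.det_fin_three, Matrix.of_apply, Matrix.cons_val, ← add_assoc,
    Nat.add_sub_cancel, sum_add_distrib, sum_sub_distrib, ← mul_sum]
  rw [h0, h1, h2]
  ring

lemma labelDet_succ (N : ℕ) (k : ℤ) (i j : ℕ) :
    labelDet (N + 1) k i j = ∑ a ∈ range i, labelDet N (k - 1) (a + 1) (j + 1) +
      ∑ b ∈ range j, labelDet N k (i + 1) (b + 1) := by
  rw [sum_labelDet_left, sum_labelDet_right, labelDet]
  simp only [Matrix.det_fin_three, Matrix.of_apply, Matrix.cons_val]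
  rw [intChoose_succ N (k + 1), intChoose_succ N k, intChoose_succ N (k - 1),
    show N + 1 + i - 1 = N + i by lia, show N + 1 + j - 1 = N + j by lia]
  push_cast
  rw [show k + 1 - 1 = k by ring, show k - 1 - 1 = k - 2 by ring,
    show (N : ℤ) + 1 - k - 2 = N - k - 1 by ring, show (N : ℤ) + 1 - k - 1 = N - k by ring,
    show (N : ℤ) + 1 - k = N - k + 1 by ring]
  ring

/-- The number of nodes reached by `N` steps from a node with label `(i, j)` in the Baxter
generating tree. -/
def descendantCount (N i j : ℕ) : ℚ := ∑ k ∈ range (N + 1), labelDet N k i j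

lemma descendantCount_zero (i j : ℕ) : descendantCount 0 i j = 1 := by
  simp [descendantCount, labelDet_zero]

lemma descendantCount_succ (N i j : ℕ) :
    descendantCount (N + 1) i j = ∑ a ∈ range i, descendantCount N (a + 1) (j + 1) +
      ∑ b ∈ range j, descendantCount N (i + 1) (b + 1) := by
  simp only [descendantCount, labelDet_succ, sum_add_distrib]
  rw [sum_comm (s := range i), sum_comm (s := range j), sum_range_succ' _ (N + 1),
    sum_range_succ _ (N + 1)]
  congr 1
  · rw [sum_eq_zero (s := range i) fun a _ ↦ labelDet_eq_zero_of_neg _ _ _ (by simp), add_zero]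
    simp
  · rw [sum_eq_zero (s := range j) fun a _ ↦ labelDet_eq_zero_of_lt _ _ _ (by simp), add_zero]

lemma labelDet_one_one (N m : ℕ) (hm : m ≤ N) :
    labelDet N m 1 1 = ((N + 2).choose m * (N + 2).choose (m + 1) * (N + 2).choose (m + 2) : ℚ) /
      ((N + 2).choose 1 * (N + 2).choose 2) := by
  have c1 := mul_intChoose_eq N m (by lia)
  have c2 := mul_intChoose_eq N (m + 1) (by lia)
  have c3 := mul_intChoose_eq N (m - 1) (by lia)
  have c4 : ((N : ℚ) - m + 2) * intChoose N (m - 2) = (m - 1) * intChoose N (m - 1) := by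
    rcases Nat.eq_zero_or_pos m with rfl | h
    · simp [intChoose_of_neg]
    · have := mul_intChoose_eq N (m - 2) (by lia)
      rw [show (m : ℤ) - 2 + 1 = m - 1 by ring] at this
      push_cast at this
      linarith
  have p0 := intChoose_succ (N + 1) m
  have p1 := intChoose_succ (N + 1) (m + 1)
  have p2 := intChoose_succ (N + 1) (m + 2)
  have q0 := intChoose_succ N (m - 1)
  have q1 := intChoose_succ N m
  have q2 := intChoose_succ N (m + 1)
  have q3 := intChoose_succ N (m + 2)
  have r0 : ((N + 2).choose m : ℚ) = intChoose (N + 2) m := (intChoose_natCast _ _).symm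
  have r1 : ((N + 2).choose (m + 1) : ℚ) = intChoose (N + 2) (m + 1) := by
    exact_mod_cast (intChoose_natCast _ (m + 1)).symm
  have r2 : ((N + 2).choose (m + 2) : ℚ) = intChoose (N + 2) (m + 2) := by
    exact_mod_cast (intChoose_natCast _ (m + 2)).symm
  rw [show (m : ℤ) + 2 - 1 = m + 1 by ring] at *
  rw [show (m : ℤ) - 1 - 1 = m - 2 by ring] at *
  rw [show (m : ℤ) + 1 + 1 = m + 2 by ring] at *
  rw [show (m : ℤ) - 1 + 1 = m by ring] at *
  rw [show (m : ℤ) + 1 - 1 = m by ring] at *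
  rw [r0, r1, r2, Nat.choose_one_right, Nat.cast_choose_two, labelDet, Matrix.det_fin_three]
  simp only [Matrix.of_apply, Matrix.cons_val, Nat.add_sub_cancel]
  rw [show (N : ℤ) - m - 2 = N - (m + 2) by ring, show (N : ℤ) - m - 1 = N - (m + 1) by ring]
  rw [intChoose_symm, intChoose_symm, intChoose_symm, p0, p1, p2, q0, q1, q2, q3]
  push_cast at *
  generalize intChoose N (m + 2) = x2 at *
  generalize intChoose N (m + 1) = x1 at *
  generalize intChoose N m = x0 at *
  generalize intChoose N (m - 1) = y1 at *
  generalize intChoose N (m - 2) = y2 at *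
  obtain ⟨l, rfl⟩ := Nat.exists_eq_add_of_le hm
  push_cast at *
  have hm1 : (m : ℚ) + 1 ≠ 0 := by positivity
  have hm2 : (m : ℚ) + 2 ≠ 0 := by positivity
  have hl1 : (l : ℚ) + 1 ≠ 0 := by positivity
  have hl2 : (l : ℚ) + 2 ≠ 0 := by positivity
  have hn1 : (m : ℚ) + l + 1 ≠ 0 := by positivity
  have hn2 : (m : ℚ) + l + 2 ≠ 0 := by positivity
  have hn3 : (m : ℚ) + l + 2 - 1 ≠ 0 := by
    rw [show (m : ℚ) + l + 2 - 1 = m + l + 1 by ring]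
    exact hn1
  have v1 : x1 = l * x0 / (m + 1) := by
    field_simp
    linarith
  have v2 : x2 = (l - 1) * x1 / (m + 2) := by
    field_simp
    linarith
  have v3 : y1 = m * x0 / (l + 1) := by
    field_simp
    linarith
  have v4 : y2 = (m - 1) * y1 / (l + 2) := by
    field_simp
    linarith
  rw [v4, v2, v3, v1]
  field_simp
  ring

/-! ### Active sites of a word -/

/-- Appending the value `v` at the end of the word `w 0, …, w (n - 1)`, and raising by one the
values at least `v`, creates no forbidden pattern that uses the new entry. -/
def IsActiveSite (n : ℕ) (w : ℕ → ℕ) (v : ℕ) : Prop :=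
  ∀ i j, i < j → j + 1 < n →
    ¬ (w (j + 1) < w i ∧ w i < v ∧ v ≤ w j) ∧ ¬ (w j < v ∧ v ≤ w i ∧ w i < w (j + 1))

/-- The word `w'` arises from the word `w` of length `n` by appending the value `v`. -/
structure IsAppend (n : ℕ) (w : ℕ → ℕ) (v : ℕ) (w' : ℕ → ℕ) : Prop where
  apply_lt : ∀ i < n, w' i = if w i < v then w i else w i + 1
  apply_last : w' n = v

section Append

variable {m v : ℕ} {w w' : ℕ → ℕ}

lemma IsAppend.isActiveSite_iff (h : IsAppend (m + 1) w v w') (u : ℕ) :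
    IsActiveSite (m + 2) w' u ↔ IsActiveSite (m + 1) w (if u ≤ v then u else u - 1) ∧
      ∀ i < m, ¬ (v < w' i ∧ w' i < u ∧ u ≤ w' m) ∧ ¬ (w' m < u ∧ u ≤ w' i ∧ w' i < v) := by
  have key : ∀ i j, i < j → j + 1 < m + 1 →
      ((¬ (w' (j + 1) < w' i ∧ w' i < u ∧ u ≤ w' j) ∧
        ¬ (w' j < u ∧ u ≤ w' i ∧ w' i < w' (j + 1))) ↔
      (¬ (w (j + 1) < w i ∧ w i < (if u ≤ v then u else u - 1) ∧
          (if u ≤ v then u else u - 1) ≤ w j) ∧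
        ¬ (w j < (if u ≤ v then u else u - 1) ∧ (if u ≤ v then u else u - 1) ≤ w i ∧
          w i < w (j + 1)))) := by
    intro i j hij hj
    rw [h.apply_lt i (by lia), h.apply_lt j (by lia), h.apply_lt (j + 1) hj]
    split_ifs <;> lia
  constructor
  · intro H
    refine ⟨fun i j hij hj ↦ (key i j hij hj).1 (H i j hij (by lia)), fun i hi ↦ ?_⟩
    simpa only [h.apply_last] using H i m hi (by lia)
  · rintro ⟨H1, H2⟩ i j hij hj
    rcases Nat.lt_or_ge (j + 1) (m + 1) with hj' | hj'
    · exact (key i j hij hj').2 (H1 i j hij hj')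
    · obtain rfl : j = m := by lia
      simpa only [h.apply_last] using H2 i hij

lemma IsAppend.isActiveSite_iff_of_le_of_le (h : IsAppend (m + 1) w v w') (hv : v ≤ w m)
    {u : ℕ} (hu : u ≤ v) : IsActiveSite (m + 2) w' u ↔ IsActiveSite (m + 1) w u := by
  have hm := h.apply_lt m (by lia)
  rw [h.isActiveSite_iff, if_pos hu, and_iff_left]
  grind

lemma IsAppend.isActiveSite_iff_of_le_of_lt (h : IsAppend (m + 1) w v w') (hv : v ≤ w m)
    (hva : IsActiveSite (m + 1) w v) (hw : w m < m + 1) (hs : ∀ x < m + 1, ∃ i < m + 1, w i = x)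
    {u : ℕ} (hu : v < u) :
    IsActiveSite (m + 2) w' u ↔ u = v + 1 ∨ (IsActiveSite (m + 1) w (u - 1) ∧ w m < u - 1) := by
  have hm := h.apply_lt m (by lia)
  have hi : ∀ i < m, w' i = if w i < v then w i else w i + 1 := fun i hi ↦ h.apply_lt i (by lia)
  rw [h.isActiveSite_iff, if_neg (by lia)]
  constructor
  · rintro ⟨h1, h2⟩
    by_contra! hc
    obtain ⟨i, hi1, hi2⟩ := hs v (by lia)
    have := hc.2 h1
    have : i ≠ m := by
      rintro rfl
      lia
    grind
  · rintro (rfl | ⟨h1, h2⟩)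
    · refine ⟨by simpa using hva, ?_⟩
      grind
    · refine ⟨h1, ?_⟩
      grind

lemma IsAppend.isActiveSite_iff_of_lt_of_le (h : IsAppend (m + 1) w v w') (hv : w m < v)
    (hva : IsActiveSite (m + 1) w v) (hvm : v ≤ m + 1) (hs : ∀ x < m + 1, ∃ i < m + 1, w i = x)
    {u : ℕ} (hu : u ≤ v) :
    IsActiveSite (m + 2) w' u ↔ u = v ∨ (IsActiveSite (m + 1) w u ∧ u ≤ w m) := by
  have hm := h.apply_lt m (by lia)
  have hi : ∀ i < m, w' i = if w i < v then w i else w i + 1 := fun i hi ↦ h.apply_lt i (by lia)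
  rw [h.isActiveSite_iff, if_pos hu]
  constructor
  · rintro ⟨h1, h2⟩
    by_contra! hc
    obtain ⟨i, hi1, hi2⟩ := hs u (by lia)
    have := hc.2 h1
    have : i ≠ m := by
      rintro rfl
      lia
    grind
  · rintro (rfl | ⟨h1, h2⟩)
    · refine ⟨hva, ?_⟩
      grind
    · refine ⟨h1, ?_⟩
      grind

lemma IsAppend.isActiveSite_iff_of_lt_of_lt (h : IsAppend (m + 1) w v w') (hv : w m < v)
    {u : ℕ} (hu : v < u) : IsActiveSite (m + 2) w' u ↔ IsActiveSite (m + 1) w (u - 1) := by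
  have hm := h.apply_lt m (by lia)
  rw [h.isActiveSite_iff, if_neg (by lia), and_iff_left]
  grind

open Classical in
/-- The active sites of a word of length `m + 1` that do not exceed its last value. -/
noncomputable def lowSites (m : ℕ) (w : ℕ → ℕ) : Finset ℕ :=
  {u ∈ range (m + 2) | IsActiveSite (m + 1) w u ∧ u ≤ w m}

open Classical in
/-- The active sites of a word of length `m + 1` that exceed its last value. -/
noncomputable def highSites (m : ℕ) (w : ℕ → ℕ) : Finset ℕ :=
  {u ∈ range (m + 2) | IsActiveSite (m + 1) w u ∧ w m < u}

lemma IsAppend.card_lowSites_of_mem_lowSites (h : IsAppend (m + 1) w v w')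
    (hv : v ∈ lowSites m w) :
    #(lowSites (m + 1) w') = #{u ∈ lowSites m w | u ≤ v} := by
  simp only [lowSites, mem_filter, mem_range] at hv
  congr 1
  ext u
  simp only [lowSites, mem_filter, mem_range, h.apply_last]
  by_cases hu : u ≤ v
  · rw [h.isActiveSite_iff_of_le_of_le hv.2.2 hu]
    grind
  · grind

lemma IsAppend.card_highSites_of_mem_lowSites (h : IsAppend (m + 1) w v w')
    (hv : v ∈ lowSites m w) (hw : w m < m + 1) (hs : ∀ x < m + 1, ∃ i < m + 1, w i = x) :
    #(highSites (m + 1) w') = #(highSites m w) + 1 := by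
  simp only [lowSites, mem_filter, mem_range] at hv
  have : highSites (m + 1) w' = insert (v + 1) ((highSites m w).image (· + 1)) := by
    ext u
    simp only [highSites, mem_filter, mem_range, h.apply_last, mem_insert, mem_image]
    by_cases hu : v < u
    · rw [h.isActiveSite_iff_of_le_of_lt hv.2.2 hv.2.1 hw hs hu]
      constructor
      · rintro ⟨h1, h2 | h2, -⟩
        · exact Or.inl h2
        · exact Or.inr ⟨u - 1, ⟨by lia, h2⟩, by lia⟩
      · rintro (h1 | ⟨x, h1, rfl⟩)
        · exact ⟨by lia, Or.inl h1, hu⟩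
        · exact ⟨by lia, Or.inr h1.2, hu⟩
    · grind
  rw [this, card_insert_of_notMem, card_image_of_injective _ (add_left_injective 1)]
  simp only [highSites, mem_image, mem_filter]
  grind

lemma IsAppend.card_lowSites_of_mem_highSites (h : IsAppend (m + 1) w v w')
    (hv : v ∈ highSites m w) (hs : ∀ x < m + 1, ∃ i < m + 1, w i = x) :
    #(lowSites (m + 1) w') = #(lowSites m w) + 1 := by
  simp only [highSites, mem_filter, mem_range] at hv
  have : lowSites (m + 1) w' = insert v (lowSites m w) := by
    ext u
    simp only [lowSites, mem_filter, mem_range, h.apply_last, mem_insert]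
    by_cases hu : u ≤ v
    · rw [h.isActiveSite_iff_of_lt_of_le hv.2.2 hv.2.1 (by lia) hs hu]
      grind
    · grind
  rw [this, card_insert_of_notMem]
  simp only [lowSites, mem_filter]
  grind

lemma IsAppend.card_highSites_of_mem_highSites (h : IsAppend (m + 1) w v w')
    (hv : v ∈ highSites m w) :
    #(highSites (m + 1) w') = #{u ∈ highSites m w | v ≤ u} := by
  simp only [highSites, mem_filter, mem_range] at hv
  have : highSites (m + 1) w' = {u ∈ highSites m w | v ≤ u}.image (· + 1) := by
    ext u
    simp only [highSites, mem_filter, mem_range, h.apply_last, mem_image]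
    by_cases hu : v < u
    · rw [h.isActiveSite_iff_of_lt_of_lt hv.2.2 hu]
      constructor
      · rintro ⟨h1, h2, -⟩
        exact ⟨u - 1, by grind, by lia⟩
      · rintro ⟨x, h1, rfl⟩
        exact ⟨by lia, h1.1.2.1, hu⟩
    · grind
  rw [this, card_image_of_injective _ (add_left_injective 1)]

end Append

lemma sum_card_filter_le (s : Finset ℕ) (f : ℕ → ℚ) :
    ∑ v ∈ s, f #{u ∈ s | u ≤ v} = ∑ a ∈ range #s, f (a + 1) := by
  induction s using Finset.induction_on_max with
  | empty => simp
  | insert x s hx ih =>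
    have hxs : x ∉ s := fun h ↦ (hx x h).false
    rw [sum_insert hxs, card_insert_of_notMem hxs, sum_range_succ, ← ih, add_comm]
    congr 1
    · refine sum_congr rfl fun v hv ↦ ?_
      rw [filter_insert, if_neg (hx v hv).not_ge]
    · rw [filter_true_of_mem (by grind), card_insert_of_notMem hxs]

lemma sum_card_filter_ge (s : Finset ℕ) (f : ℕ → ℚ) :
    ∑ v ∈ s, f #{u ∈ s | v ≤ u} = ∑ a ∈ range #s, f (a + 1) := by
  induction s using Finset.induction_on_min with
  | empty => simp
  | insert x s hx ih =>
    have hxs : x ∉ s := fun h ↦ (hx x h).false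
    rw [sum_insert hxs, card_insert_of_notMem hxs, sum_range_succ, ← ih, add_comm]
    congr 1
    · refine sum_congr rfl fun v hv ↦ ?_
      rw [filter_insert, if_neg (hx v hv).not_ge]
    · rw [filter_true_of_mem (by grind), card_insert_of_notMem hxs]

/-! ### Appending a value to a permutation -/

/-- The word of values of a permutation of `Fin n`, extended by zero. -/
def permWord {n : ℕ} (π : Equiv.Perm (Fin n)) (i : ℕ) : ℕ :=
  if h : i < n then (π ⟨i, h⟩ : ℕ) else 0

lemma permWord_of_lt {n : ℕ} (π : Equiv.Perm (Fin n)) {i : ℕ} (h : i < n) :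
    permWord π i = π ⟨i, h⟩ := dif_pos h

lemma permWord_lt {n : ℕ} (π : Equiv.Perm (Fin n)) {i : ℕ} (h : i < n) : permWord π i < n := by
  rw [permWord_of_lt π h]
  exact (π _).isLt

lemma exists_permWord_eq {n : ℕ} (π : Equiv.Perm (Fin n)) (x : ℕ) (h : x < n) :
    ∃ i < n, permWord π i = x := by
  refine ⟨π.symm ⟨x, h⟩, (π.symm ⟨x, h⟩).isLt, ?_⟩
  rw [permWord_of_lt π (π.symm ⟨x, h⟩).isLt]
  simp

lemma isBaxter_iff {n : ℕ} (π : Equiv.Perm (Fin n)) :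
    IsBaxter π ↔ ∀ i j k, i < j → j < k → k < n →
      ¬ (permWord π (j + 1) < permWord π i ∧ permWord π i < permWord π k ∧
          permWord π k < permWord π j) ∧
      ¬ (permWord π j < permWord π k ∧ permWord π k < permWord π i ∧
          permWord π i < permWord π (j + 1)) := by
  rw [IsBaxter]
  constructor
  · intro H i j k hij hjk hk
    rw [permWord_of_lt π hk, permWord_of_lt π (hjk.trans hk),
      permWord_of_lt π (hij.trans (hjk.trans hk)), permWord_of_lt π (by lia : j + 1 < n),
      ← not_or]
    exact fun h ↦ H ⟨⟨i, _⟩, ⟨j, _⟩, ⟨k, _⟩, by lia, hij, hjk, h⟩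
  · rintro H ⟨i, j, k, hj, hij, hjk, h⟩
    have := H i j k hij hjk k.isLt
    rw [permWord_of_lt π k.isLt, permWord_of_lt π j.isLt, permWord_of_lt π i.isLt,
      permWord_of_lt π hj, ← not_or] at this
    exact this h

/-- Append the value `v` at the end of a permutation, raising by one the values at least `v`. -/
def appendPerm {n : ℕ} (v : Fin (n + 1)) (π : Equiv.Perm (Fin n)) : Equiv.Perm (Fin (n + 1)) :=
  ((finSuccEquiv' (Fin.last n)).trans π.optionCongr).trans (finSuccEquiv' v).symm

lemma appendPerm_last {n : ℕ} (v : Fin (n + 1)) (π : Equiv.Perm (Fin n)) :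
    appendPerm v π (Fin.last n) = v := by
  simp [appendPerm]

lemma appendPerm_castSucc {n : ℕ} (v : Fin (n + 1)) (π : Equiv.Perm (Fin n)) (i : Fin n) :
    appendPerm v π i.castSucc = v.succAbove (π i) := by
  simp [appendPerm, finSuccEquiv'_last_apply_castSucc]

lemma isAppend_appendPerm {n : ℕ} (v : Fin (n + 1)) (π : Equiv.Perm (Fin n)) :
    IsAppend n (permWord π) v (permWord (appendPerm v π)) where
  apply_lt i hi := by
    have := appendPerm_castSucc v π ⟨i, hi⟩
    rw [Fin.castSucc_mk] at this
    rw [permWord_of_lt _ (by lia), permWord_of_lt _ hi, this, Fin.succAbove]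
    simp only [Fin.lt_def, Fin.val_castSucc]
    split_ifs <;> simp
  apply_last := by
    rw [permWord_of_lt _ (by lia)]
    exact congrArg Fin.val (appendPerm_last v π)

lemma appendPerm_bijective (n : ℕ) :
    Function.Bijective fun p : Fin (n + 1) × Equiv.Perm (Fin n) ↦ appendPerm p.1 p.2 := by
  rw [Fintype.bijective_iff_injective_and_card]
  refine ⟨?_, by simp [Fintype.card_perm, Nat.factorial_succ]⟩
  rintro ⟨v, π⟩ ⟨u, ρ⟩ h
  dsimp only at h
  obtain rfl : v = u := by rw [← appendPerm_last v π, h, appendPerm_last]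
  obtain rfl : π = ρ := by
    ext1 i
    have := appendPerm_castSucc v π i
    rw [h, appendPerm_castSucc] at this
    exact (Fin.succAbove_right_injective this).symm
  rfl

lemma isBaxter_appendPerm {n : ℕ} (v : Fin (n + 1)) (π : Equiv.Perm (Fin n)) :
    IsBaxter (appendPerm v π) ↔ IsBaxter π ∧ IsActiveSite n (permWord π) v := by
  have h := isAppend_appendPerm v π
  rw [isBaxter_iff, isBaxter_iff]
  generalize permWord (appendPerm v π) = w' at *
  constructor
  · intro H
    constructor
    · intro i j k hij hjk hk
      have := H i j k hij hjk (by lia)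
      rw [h.apply_lt i (by lia), h.apply_lt j (by lia), h.apply_lt k hk,
        h.apply_lt (j + 1) (by lia)] at this
      grind
    · intro i j hij hj
      have := H i j n hij (by lia) (by lia)
      rw [h.apply_lt i (by lia), h.apply_lt j (by lia), h.apply_last, h.apply_lt (j + 1) hj]
        at this
      grind
  · rintro ⟨H1, H2⟩ i j k hij hjk hk
    rcases Nat.lt_or_ge k n with hk' | hk'
    · have := H1 i j k hij hjk hk'
      rw [h.apply_lt i (by lia), h.apply_lt j (by lia), h.apply_lt k hk',
        h.apply_lt (j + 1) (by lia)]
      grind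
    · obtain rfl : k = n := by lia
      rcases Nat.lt_or_ge (j + 1) k with hj | hj
      · have := H2 i j hij hj
        rw [h.apply_lt i (by lia), h.apply_lt j (by lia), h.apply_last, h.apply_lt (j + 1) hj]
        grind
      · obtain rfl : k = j + 1 := by lia
        lia

open Classical in
/-- The sum of a function of the label over the Baxter permutations of size `m + 1`. -/
noncomputable def baxterSum (m : ℕ) (f : ℕ → ℕ → ℚ) : ℚ :=
  ∑ π : Equiv.Perm (Fin (m + 1)) with IsBaxter π,
    f #(lowSites m (permWord π)) #(highSites m (permWord π))

lemma baxterSum_succ (m : ℕ) (f : ℕ → ℕ → ℚ) :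
    baxterSum (m + 1) f = baxterSum m fun i j ↦
      ∑ a ∈ range i, f (a + 1) (j + 1) + ∑ b ∈ range j, f (i + 1) (b + 1) := by
  classical
  rw [baxterSum, baxterSum, sum_filter, sum_filter, ← (appendPerm_bijective (m + 1)).sum_comp
    fun σ ↦ if IsBaxter σ then
      f #(lowSites (m + 1) (permWord σ)) #(highSites (m + 1) (permWord σ)) else 0,
    Fintype.sum_prod_type, sum_comm]
  refine sum_congr rfl fun π _ ↦ ?_
  simp only [isBaxter_appendPerm]
  by_cases hπ : IsBaxter π
  swap
  · simp [hπ]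
  simp only [hπ, true_and, if_true]
  set w := permWord π with hw
  have hlast : w m < m + 1 := permWord_lt π (by lia)
  have hs : ∀ x < m + 1, ∃ i < m + 1, w i = x := exists_permWord_eq π
  let g : ℕ → ℚ := fun v ↦ if v ∈ lowSites m w then f #{u ∈ lowSites m w | u ≤ v}
    (#(highSites m w) + 1) else if v ∈ highSites m w then
      f (#(lowSites m w) + 1) #{u ∈ highSites m w | v ≤ u} else 0
  have hdisj : ∀ v ∈ highSites m w, v ∉ lowSites m w := by
    intro v
    simp only [lowSites, highSites, mem_filter]
    lia
  calc
    _ = ∑ v : Fin (m + 2), g v := by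
      refine sum_congr rfl fun v _ ↦ ?_
      have h := isAppend_appendPerm v π
      by_cases hl : (v : ℕ) ∈ lowSites m w
      · rw [if_pos (by simp only [lowSites, mem_filter] at hl; exact hl.2.1),
          h.card_lowSites_of_mem_lowSites hl, h.card_highSites_of_mem_lowSites hl hlast hs]
        simp [g, hl, ← hw]
      by_cases hh : (v : ℕ) ∈ highSites m w
      · rw [if_pos (by simp only [highSites, mem_filter] at hh; exact hh.2.1),
          h.card_lowSites_of_mem_highSites hh hs, h.card_highSites_of_mem_highSites hh]
        simp [g, hl, hh, ← hw]
      · rw [if_neg]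
        · simp [g, hl, hh]
        · have := v.isLt
          simp only [lowSites, highSites, mem_filter, mem_range] at hl hh
          grind
    _ = ∑ v ∈ range (m + 2), g v := Fin.sum_univ_eq_sum_range g (m + 2)
    _ = ∑ v ∈ lowSites m w ∪ highSites m w, g v := by
      refine (sum_subset ?_ ?_).symm
      · exact union_subset (filter_subset _ _) (filter_subset _ _)
      · intro v _ hv
        rw [mem_union, not_or] at hv
        simp [g, hv.1, hv.2]
    _ = ∑ v ∈ lowSites m w, g v + ∑ v ∈ highSites m w, g v :=
      sum_union (disjoint_right.mpr hdisj)
    _ = _ := by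
      rw [← sum_card_filter_le (lowSites m w) fun a ↦ f a (#(highSites m w) + 1),
        ← sum_card_filter_ge (highSites m w) fun b ↦ f (#(lowSites m w) + 1) b]
      congr 1
      · exact sum_congr rfl fun v hv ↦ if_pos hv
      · exact sum_congr rfl fun v hv ↦ by simp [g, hdisj v hv, hv]

lemma baxterSum_zero (f : ℕ → ℕ → ℚ) : baxterSum 0 f = f 1 1 := by
  classical
  have hb : ∀ π : Equiv.Perm (Fin 1), IsBaxter π := by
    rintro π ⟨i, j, k, hj, -⟩
    lia
  have ha : ∀ w u, IsActiveSite 1 w u := fun w u i j hij hj ↦ by lia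
  have hl : ∀ π : Equiv.Perm (Fin 1), lowSites 0 (permWord π) = {0} := by
    intro π
    have := permWord_lt π one_pos
    ext u
    simp only [lowSites, ha, mem_filter, mem_range, mem_singleton]
    lia
  have hh : ∀ π : Equiv.Perm (Fin 1), highSites 0 (permWord π) = {1} := by
    intro π
    have := permWord_lt π one_pos
    ext u
    simp only [highSites, ha, mem_filter, mem_range, mem_singleton]
    lia
  simp [baxterSum, hb, hl, hh]

lemma baxterSum_descendantCount (m N : ℕ) :
    baxterSum m (descendantCount N) = descendantCount (N + m) 1 1 := by
  induction m generalizing N with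
  | zero => exact baxterSum_zero _
  | succ m ih =>
    rw [baxterSum_succ, ← add_assoc, Nat.add_right_comm, ← ih]
    simp only [← descendantCount_succ]

open Nat in
theorem baxter_count {n : ℕ} (hn : 1 ≤ n) :
    (Nat.card {π : Equiv.Perm (Fin n) // IsBaxter π} : ℚ) =
      ∑ m ∈ Finset.range n,
        ((n + 1).choose m * (n + 1).choose (m + 1) * (n + 1).choose (m + 2) : ℚ) /
          ((n + 1).choose 1 * (n + 1).choose 2) := by
  classical
  obtain ⟨N, rfl⟩ := Nat.exists_eq_add_of_le' hn
  have hcard : (Nat.card {π : Equiv.Perm (Fin (N + 1)) // IsBaxter π} : ℚ) =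
      baxterSum N (descendantCount 0) := by
    rw [Nat.card_eq_fintype_card, Fintype.card_subtype]
    simp [baxterSum, descendantCount_zero]
  rw [hcard, baxterSum_descendantCount, Nat.zero_add, descendantCount]
  refine Finset.sum_congr rfl fun m hm ↦ ?_
  exact labelDet_one_one N m (Nat.lt_succ_iff.mp (Finset.mem_range.mp hm))
end

section
/- The number of permutations of size n avoiding both patterns 2413 and 3142 is the n-th large Schröder number, i.e., ∑_{k=0}^{n-1} (n-1+k)! / (k! (k+1)! (n-1-k)!). -/
def Contains2413 {n : ℕ} (π : Equiv.Perm (Fin n)) : Prop :=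
  ∃ i₁ i₂ i₃ i₄ : Fin n, i₁ < i₂ ∧ i₂ < i₃ ∧ i₃ < i₄ ∧
    π i₃ < π i₁ ∧ π i₁ < π i₄ ∧ π i₄ < π i₂

def Contains3142 {n : ℕ} (π : Equiv.Perm (Fin n)) : Prop :=
  ∃ i₁ i₂ i₃ i₄ : Fin n, i₁ < i₂ ∧ i₂ < i₃ ∧ i₃ < i₄ ∧
    π i₂ < π i₄ ∧ π i₄ < π i₁ ∧ π i₁ < π i₃

/-- No sublist of `l` of length four is in the relative order `2413` with respect to `r`. -/
def Avoids2413 (r : ℕ → ℕ → Prop) (l : List ℕ) : Prop :=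
  ∀ a b c d, [a, b, c, d].Sublist l → r c a → r a d → ¬ r d b

/-- A list avoiding `2413` and `3142`, the latter being `2413` for the reversed order. -/
def IsSeparableList (l : List ℕ) : Prop :=
  Avoids2413 (· < ·) l ∧ Avoids2413 (· > ·) l

/-- `l` is a concatenation of two nonempty lists with all entries of the first `r`-related to all
entries of the second. -/
def IsDecomposable (r : ℕ → ℕ → Prop) (l : List ℕ) : Prop :=
  ∃ u v, u ≠ [] ∧ v ≠ [] ∧ l = u ++ v ∧ ∀ a ∈ u, ∀ b ∈ v, r a b

theorem Avoids2413.sublist {r : ℕ → ℕ → Prop} {l l' : List ℕ} (h : Avoids2413 r l)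
    (hl : l'.Sublist l) : Avoids2413 r l' :=
  fun a b c d hs => h a b c d (hs.trans hl)

theorem IsSeparableList.sublist {l l' : List ℕ} (h : IsSeparableList l) (hl : l'.Sublist l) :
    IsSeparableList l' :=
  ⟨h.1.sublist hl, h.2.sublist hl⟩

theorem Avoids2413.reverse {r : ℕ → ℕ → Prop} {l : List ℕ} (h : Avoids2413 (flip r) l) :
    Avoids2413 r l.reverse := by
  intro a b c d hs hca had hdb
  exact h d c b a (by simpa using List.sublist_reverse_iff.1 hs) hdb had hca

theorem IsSeparableList.reverse {l : List ℕ} (h : IsSeparableList l) : IsSeparableList l.reverse :=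
  ⟨Avoids2413.reverse h.2, Avoids2413.reverse h.1⟩

theorem IsDecomposable.reverse {r : ℕ → ℕ → Prop} {l : List ℕ} (h : IsDecomposable r l) :
    IsDecomposable (flip r) l.reverse := by
  obtain ⟨u, v, hu, hv, rfl, h⟩ := h
  exact ⟨v.reverse, u.reverse, by simpa, by simpa, by simp,
    fun a ha b hb => h b (by simpa using hb) a (by simpa using ha)⟩

theorem Avoids2413.append {r : ℕ → ℕ → Prop} [Std.Asymm r] {u v : List ℕ}
    (hu : Avoids2413 r u) (hv : Avoids2413 r v)
    (h : (∀ a ∈ u, ∀ b ∈ v, r a b) ∨ (∀ a ∈ u, ∀ b ∈ v, r b a)) : Avoids2413 r (u ++ v) := by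
  have asymm : ∀ a b, r a b → ¬ r b a := fun a b => Std.Asymm.asymm a b
  intro a b c d hs hca had hdb
  obtain ⟨l₁, l₂, heq, h₁, h₂⟩ := List.sublist_append_iff.1 hs
  have hu' : ¬ [a, b, c, d].Sublist u := fun hs => hu a b c d hs hca had hdb
  have hv' : ¬ [a, b, c, d].Sublist v := fun hs => hv a b c d hs hca had hdb
  have hm₁ := h₁.subset
  have hm₂ := h₂.subset
  clear hs hu hv
  rcases l₁ with _ | ⟨a, _ | ⟨b, _ | ⟨c, _ | ⟨d, _ | ⟨e, l⟩⟩⟩⟩⟩ <;> simp at heq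
  all_goals
    try casesm* _ ∧ _
    subst_vars
    first
    | exact hv' h₂
    | exact hu' h₁
    | clear h₁ h₂ hu' hv'
      simp at hm₁ hm₂
      grind

theorem IsSeparableList.append {u v : List ℕ} (hu : IsSeparableList u) (hv : IsSeparableList v)
    (h : ∀ a ∈ u, ∀ b ∈ v, a < b) : IsSeparableList (u ++ v) :=
  ⟨hu.1.append hv.1 (.inl h), hu.2.append hv.2 (.inr h)⟩

/-- A decomposition with the shortest possible first part has an indecomposable first part. -/
theorem IsDecomposable.exists_indecomposable {r : ℕ → ℕ → Prop} [IsTrans ℕ r] {l : List ℕ}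
    (h : IsDecomposable r l) :
    ∃ u v, u ≠ [] ∧ v ≠ [] ∧ l = u ++ v ∧ (∀ a ∈ u, ∀ b ∈ v, r a b) ∧ ¬ IsDecomposable r u := by
  obtain ⟨u, v, hu, hv, rfl, h⟩ := h
  induction hn : u.length using Nat.strong_induction_on generalizing u v with
  | _ n ih =>
    by_cases hd : IsDecomposable r u
    · obtain ⟨p, q, hp, hq, rfl, hpq⟩ := hd
      obtain ⟨x, hx⟩ := List.exists_mem_of_ne_nil _ hq
      have := ih p.length (by
        have := List.length_pos_iff.2 hq
        simp at hn; omega) p (q ++ v) hp (by simp [hv]) (by grind) rfl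
      simpa using this
    · exact ⟨u, v, hu, hv, rfl, h, hd⟩

theorem Avoids2413.isDecomposable_concat {r : ℕ → ℕ → Prop} [IsStrictTotalOrder ℕ r]
    {u v : List ℕ} {x : ℕ} (hu : u ≠ []) (hv : v ≠ []) (huv : ∀ a ∈ u, ∀ b ∈ v, r a b)
    (hx : x ∉ u) (hav : Avoids2413 (flip r) (u ++ v ++ [x]))
    (hdec : u.length = 1 ∨ IsDecomposable (flip r) u) :
    IsDecomposable r (u ++ v ++ [x]) ∨ IsDecomposable (flip r) (u ++ v ++ [x]) := by
  have htri : ∀ a ∈ u, r a x ∨ r x a := fun a ha => by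
    rcases trichotomous_of r a x with h | h | h
    · exact .inl h
    · exact absurd (h ▸ ha) hx
    · exact .inr h
  have htrans : ∀ {a b c}, r a b → r b c → r a c := fun {a b c} => _root_.trans
  by_cases h₁ : ∀ a ∈ u, r a x
  · exact .inl ⟨u, v ++ [x], hu, by simp, by simp, by grind⟩
  by_cases h₂ : ∀ a ∈ u, r x a
  · obtain ⟨y, hy⟩ := List.exists_mem_of_ne_nil _ hu
    refine .inr ⟨u ++ v, [x], by simp [hu], by simp, rfl, ?_⟩
    simp only [flip]
    grind
  exfalso
  push Not at h₁ h₂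
  obtain ⟨b, hb, hbx⟩ := h₁
  obtain ⟨a, ha, hax⟩ := h₂
  have hbx := (htri b hb).resolve_left hbx
  have hax := (htri a ha).resolve_right hax
  rcases hdec with hlen | ⟨p, q, hp, hq, rfl, hpq⟩
  · obtain ⟨y, rfl⟩ := List.length_eq_one_iff.1 hlen
    simp only [List.mem_singleton] at ha hb
    subst ha hb
    exact irrefl_of r x (htrans hbx hax)
  · simp only [flip] at hpq
    obtain ⟨p', hp', hp'x⟩ : ∃ p' ∈ p, r x p' := by
      obtain ⟨y, hy⟩ := List.exists_mem_of_ne_nil _ hp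
      grind
    obtain ⟨q', hq', hq'x⟩ : ∃ q' ∈ q, r q' x := by
      obtain ⟨y, hy⟩ := List.exists_mem_of_ne_nil _ hq
      grind
    obtain ⟨v', hv'⟩ := List.exists_mem_of_ne_nil _ hv
    refine hav p' q' v' x ?_ (huv p' (by simp [hp']) v' hv') hp'x hq'x
    exact (((List.singleton_sublist.2 hp').append (List.singleton_sublist.2 hq')).append
      (List.singleton_sublist.2 hv')).append (List.Sublist.refl [x])

theorem IsSeparableList.isDecomposable {l : List ℕ} (h : IsSeparableList l) (hl : l.Nodup)
    (hlen : 2 ≤ l.length) : IsDecomposable (· < ·) l ∨ IsDecomposable (· > ·) l := by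
  induction hn : l.length using Nat.strong_induction_on generalizing l with
  | _ n ih =>
    subst hn
    obtain rfl | ⟨l, x, rfl⟩ := List.eq_nil_or_concat' l
    · simp at hlen
    have hl' : l.Nodup := hl.sublist (List.sublist_append_left _ _)
    have hx : x ∉ l := by grind
    have hlen' : l.length + 1 = (l ++ [x]).length := by simp
    by_cases h1 : l.length = 1
    · obtain ⟨y, rfl⟩ := List.length_eq_one_iff.1 h1
      have : x ≠ y := by simpa using hx
      rcases lt_or_gt_of_ne this with hxy | hxy
      · exact .inr ⟨[y], [x], by simp, by simp, rfl, by simpa⟩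
      · exact .inl ⟨[y], [x], by simp, by simp, rfl, by simpa⟩
    rcases ih l.length (by omega) (h.sublist (List.sublist_append_left _ _)) hl' (by omega) rfl
      with hd | hd <;> obtain ⟨u, v, hu, hv, rfl, huv, hi⟩ := hd.exists_indecomposable
    all_goals
      have hu0 := List.length_pos_iff.2 hu
      have hsub : u.Sublist (u ++ v ++ [x]) := by simp
      have hu' : u.length = 1 ∨ 2 ≤ u.length := by omega
      have hvl := List.length_pos_iff.2 hv
      have hux : x ∉ u := fun hxu => hx (List.mem_append_left _ hxu)
      have hih := fun h2 => ih u.length (by simp) (h.sublist hsub) (hl.sublist hsub) h2 rfl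
    · exact Avoids2413.isDecomposable_concat hu hv huv hux h.2
        (hu'.imp_right fun h2 => (hih h2).resolve_left hi)
    · exact (Avoids2413.isDecomposable_concat (r := (· > ·)) hu hv huv hux h.1
        (hu'.imp_right fun h2 => (hih h2).resolve_right hi)).symm

theorem IsDecomposable.not_flip {r : ℕ → ℕ → Prop} [Std.Asymm r] {l : List ℕ}
    (h : IsDecomposable r l) : ¬ IsDecomposable (flip r) l := by
  rintro ⟨p, q, hp, hq, rfl, hpq⟩
  obtain ⟨u, v, hu, hv, heq, huv⟩ := h
  have asymm : ∀ a b, r a b → ¬ r b a := fun a b => Std.Asymm.asymm a b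
  rcases p with _ | ⟨x, p⟩
  · exact hp rfl
  rcases u with _ | ⟨y, u⟩
  · exact hu rfl
  obtain rfl | ⟨q, z, rfl⟩ := List.eq_nil_or_concat' q
  · exact hq rfl
  obtain rfl | ⟨v, w, rfl⟩ := List.eq_nil_or_concat' v
  · exact hv rfl
  obtain ⟨rfl, heq⟩ := List.cons_eq_cons.1 heq
  rw [← List.append_assoc, ← List.append_assoc] at heq
  obtain ⟨-, heq⟩ := List.append_inj' heq rfl
  obtain rfl : z = w := by simpa using heq
  exact asymm x z (huv x (by simp) z (by simp)) (hpq x (by simp) z (by simp))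

theorem append_perm_range'_iff {u v : List ℕ} {a n : ℕ} (h : ∀ x ∈ u, ∀ y ∈ v, x < y) :
    (u ++ v).Perm (List.range' a n) ↔ u.length + v.length = n ∧
      u.Perm (List.range' a u.length) ∧ v.Perm (List.range' (a + u.length) v.length) := by
  constructor
  · intro hp
    have hlen : u.length + v.length = n := by simpa using hp.length_eq
    have hs : u.mergeSort ++ v.mergeSort = List.range' a n := by
      refine List.Perm.eq_of_pairwise' (r := (· ≤ ·)) ?_ ?_
        (((List.mergeSort_perm _ _).append (List.mergeSort_perm _ _)).trans hp)
      · rw [List.pairwise_append]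
        refine ⟨List.pairwise_mergeSort' _ u, List.pairwise_mergeSort' _ v, ?_⟩
        intro x hx y hy
        exact (h x (by simpa using hx) y (by simpa using hy)).le
      · exact (List.pairwise_lt_range' (s := a) (n := n)).imp le_of_lt
    rw [← hlen, ← List.range'_append_1] at hs
    obtain ⟨h₁, h₂⟩ := List.append_inj hs (by simp)
    exact ⟨hlen, h₁ ▸ (List.mergeSort_perm u _).symm, h₂ ▸ (List.mergeSort_perm v _).symm⟩
  · rintro ⟨rfl, hu, hv⟩
    rw [← List.range'_append_1]
    exact hu.append hv

open Classical in
/-- The separable arrangements of `a, a + 1, …, a + n - 1`. -/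
noncomputable def separableLists (a n : ℕ) : Finset (List ℕ) :=
  (List.range' a n).permutations.toFinset.filter IsSeparableList

theorem mem_separableLists {a n : ℕ} {l : List ℕ} :
    l ∈ separableLists a n ↔ l.Perm (List.range' a n) ∧ IsSeparableList l := by
  simp [separableLists]

open Classical in
theorem card_filter_isDecomposable_separableLists (a n : ℕ) :
    ((separableLists a n).filter (IsDecomposable (· < ·))).card =
      ∑ i ∈ Finset.Ico 1 n,
        ((separableLists a i).filter fun l => ¬ IsDecomposable (· < ·) l).card *
          (separableLists (a + i) (n - i)).card := by
  simp_rw [← Finset.card_product]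
  rw [← Finset.card_sigma]
  symm
  refine Finset.card_bij (fun x _ => x.2.1 ++ x.2.2) ?_ ?_ ?_
  · rintro ⟨i, u, v⟩ hx
    simp only [Finset.mem_sigma, Finset.mem_Ico, Finset.mem_product, Finset.mem_filter,
      mem_separableLists] at hx ⊢
    obtain ⟨⟨hi, hin⟩, ⟨⟨hu, hus⟩, -⟩, hv, hvs⟩ := hx
    have hul : u.length = i := by simpa using hu.length_eq
    have hvl : v.length = n - i := by simpa using hv.length_eq
    have huv : ∀ x ∈ u, ∀ y ∈ v, x < y := fun x hx y hy => by
      have := hu.subset hx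
      have := hv.subset hy
      simp only [List.mem_range'_1] at *
      omega
    refine ⟨⟨(append_perm_range'_iff huv).2 ⟨by omega, hul ▸ hu, ?_⟩, hus.append hvs huv⟩,
      u, v, ?_, ?_, rfl, huv⟩
    · rwa [hul, hvl]
    · rintro rfl
      simp at hul
      omega
    · rintro rfl
      simp at hvl
      omega
  · rintro ⟨i, u, v⟩ hx ⟨j, p, q⟩ hy heq
    simp only [Finset.mem_sigma, Finset.mem_Ico, Finset.mem_product, Finset.mem_filter,
      mem_separableLists] at hx hy heq
    obtain ⟨⟨hi, hin⟩, ⟨⟨hu, -⟩, hud⟩, hv, -⟩ := hx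
    obtain ⟨⟨hj, hjn⟩, ⟨⟨hp, -⟩, hpd⟩, hq, -⟩ := hy
    have key : ∀ {s t w z : List ℕ} {i j : ℕ}, 1 ≤ i → s.Perm (List.range' a i) →
        t.Perm (List.range' a j) → w.Perm (List.range' (a + i) (n - i)) →
        ¬ IsDecomposable (· < ·) t → s ++ w = t ++ z → ¬ i < j := by
      intro s t w z i j hi hs ht hw htd heq hij
      have hsl : s.length = i := by simpa using hs.length_eq
      have htl : t.length = j := by simpa using ht.length_eq
      obtain ⟨r, rfl, rfl⟩ | ⟨r, rfl, rfl⟩ := List.append_eq_append_iff.1 heq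
      · refine htd ⟨s, r, ?_, ?_, rfl, fun x hx y hy => ?_⟩
        · rintro rfl
          simp at hsl
          omega
        · rintro rfl
          simp at htl
          omega
        · have := hs.subset hx
          have := hw.subset (List.mem_append_left _ hy)
          simp only [List.mem_range'_1] at *
          omega
      · simp at hsl
        omega
    obtain rfl : i = j :=
      le_antisymm (not_lt.1 (key hj hp hu hq hud heq.symm)) (not_lt.1 (key hi hu hp hv hpd heq))
    obtain ⟨rfl, rfl⟩ := List.append_inj heq (hu.length_eq.trans hp.length_eq.symm)
    rfl
  · intro l hl
    rw [Finset.mem_filter, mem_separableLists] at hl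
    obtain ⟨⟨hp, hs⟩, hd⟩ := hl
    obtain ⟨u, v, hu, hv, rfl, huv, hi⟩ := hd.exists_indecomposable
    obtain ⟨hlen, hup, hvp⟩ := (append_perm_range'_iff huv).1 hp
    have hu0 := List.length_pos_iff.2 hu
    have hv0 := List.length_pos_iff.2 hv
    refine ⟨⟨u.length, u, v⟩, ?_, rfl⟩
    simp only [Finset.mem_sigma, Finset.mem_Ico, Finset.mem_product, Finset.mem_filter,
      mem_separableLists]
    refine ⟨by omega, ⟨⟨hup, hs.sublist (List.sublist_append_left _ _)⟩, hi⟩, ?_,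
      hs.sublist (List.sublist_append_right _ _)⟩
    rwa [show n - u.length = v.length by omega]

open Classical in
theorem card_separableLists_eq_two_mul {a n : ℕ} (hn : 2 ≤ n) :
    (separableLists a n).card =
      2 * ((separableLists a n).filter (IsDecomposable (· < ·))).card := by
  have hrev : ((separableLists a n).filter (IsDecomposable (· < ·))).card =
      ((separableLists a n).filter fun l => ¬ IsDecomposable (· < ·) l).card := by
    refine Finset.card_bij' (fun l _ => l.reverse) (fun l _ => l.reverse) ?_ ?_ (by simp) (by simp)
    · intro l hl
      simp only [Finset.mem_filter, mem_separableLists] at hl ⊢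
      exact ⟨⟨l.reverse_perm.trans hl.1.1, hl.1.2.reverse⟩,
        IsDecomposable.not_flip (r := (· > ·)) hl.2.reverse⟩
    · intro l hl
      simp only [Finset.mem_filter, mem_separableLists] at hl ⊢
      refine ⟨⟨l.reverse_perm.trans hl.1.1, hl.1.2.reverse⟩, ?_⟩
      refine IsDecomposable.reverse (r := (· > ·)) ((hl.1.2.isDecomposable
        (hl.1.1.nodup_iff.2 List.nodup_range') ?_).resolve_left hl.2)
      simpa [hl.1.1.length_eq]
  rw [← Finset.card_filter_add_card_filter_not (s := separableLists a n)
    (IsDecomposable (· < ·)), ← hrev, two_mul]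

theorem separableLists_one (a : ℕ) : separableLists a 1 = {[a]} := by
  ext l
  rw [mem_separableLists]
  simp only [List.range'_one, List.perm_singleton, Finset.mem_singleton, and_iff_left_iff_imp]
  rintro rfl
  constructor <;> intro x y z w h <;> simpa using h.length_le

open Classical in
theorem card_filter_not_isDecomposable_separableLists_one (a : ℕ) :
    ((separableLists a 1).filter fun l => ¬ IsDecomposable (· < ·) l).card = 1 := by
  rw [separableLists_one, Finset.filter_true_of_mem, Finset.card_singleton]
  rintro l hl ⟨u, v, hu, hv, rfl, -⟩
  have := List.length_pos_iff.2 hu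
  have := List.length_pos_iff.2 hv
  have := congrArg List.length (Finset.mem_singleton.1 hl)
  simp at this
  omega

theorem card_separableLists (a n : ℕ) : (separableLists a (n + 1)).card = n.largeSchroder := by
  classical
  induction n using Nat.strong_induction_on generalizing a with
  | _ n ih =>
    rcases n with _ | m
    · simp [separableLists_one]
    have hind : ∀ i, 1 ≤ i → i ≤ m →
        2 * ((separableLists a (i + 1)).filter fun l => ¬ IsDecomposable (· < ·) l).card =
          i.largeSchroder := fun i h₁ h₂ => by
      have h := Finset.card_filter_add_card_filter_not (s := separableLists a (i + 1))
        (IsDecomposable (· < ·))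
      have h' := card_separableLists_eq_two_mul (a := a) (n := i + 1) (by omega)
      rw [← ih i (by omega) a]
      omega
    rw [card_separableLists_eq_two_mul (by omega), card_filter_isDecomposable_separableLists,
      Nat.largeSchroder_succ, ← Nat.range_succ_eq_Iic, Finset.sum_Ico_eq_sum_range,
      show m + 1 + 1 - 1 = m + 1 by omega, Finset.sum_range_succ', Finset.sum_range_succ',
      mul_add, Finset.mul_sum]
    have h0 : (separableLists (a + (1 + 0)) (m + 1 + 1 - (1 + 0))).card = m.largeSchroder :=
      ih m (by omega) _
    rw [h0, card_filter_not_isDecomposable_separableLists_one]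
    have hs : ∀ i ∈ Finset.range m,
        2 * (((separableLists a (1 + (i + 1))).filter fun l => ¬ IsDecomposable (· < ·) l).card *
          (separableLists (a + (1 + (i + 1))) (m + 1 + 1 - (1 + (i + 1)))).card) =
        (i + 1).largeSchroder * (m - (i + 1)).largeSchroder := fun i hi => by
      have hi := Finset.mem_range.1 hi
      rw [← mul_assoc, add_comm 1 (i + 1), hind (i + 1) (by omega) (by omega),
        show m + 1 + 1 - (i + 1 + 1) = m - (i + 1) + 1 by omega, ih _ (by omega)]
    rw [Finset.sum_congr rfl hs]
    simp
    ring

theorem sublist_ofFn_iff {α : Type*} {n : ℕ} (f : Fin n → α) (a b c d : α) :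
    [a, b, c, d].Sublist (List.ofFn f) ↔
      ∃ i₁ i₂ i₃ i₄ : Fin n, i₁ < i₂ ∧ i₂ < i₃ ∧ i₃ < i₄ ∧
        a = f i₁ ∧ b = f i₂ ∧ c = f i₃ ∧ d = f i₄ := by
  rw [List.ofFn_eq_map, List.sublist_map_iff]
  constructor
  · rintro ⟨l, hl, heq⟩
    have hp := (List.pairwise_lt_finRange n).sublist hl
    rcases l with _ | ⟨i₁, _ | ⟨i₂, _ | ⟨i₃, _ | ⟨i₄, _ | ⟨i₅, l⟩⟩⟩⟩⟩ <;> simp at heq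
    simp at hp
    exact ⟨i₁, i₂, i₃, i₄, by tauto⟩
  · rintro ⟨i₁, i₂, i₃, i₄, h₁, h₂, h₃, rfl, rfl, rfl, rfl⟩
    have hp : [i₁, i₂, i₃, i₄].Pairwise (· < ·) := by
      simp
      omega
    exact ⟨_, List.sublist_of_subperm_of_pairwise (List.subperm_of_subset
      (hp.imp ne_of_lt) (fun i _ => List.mem_finRange i)) hp (List.pairwise_lt_finRange n), rfl⟩

theorem isSeparableList_ofFn_iff {n : ℕ} (π : Equiv.Perm (Fin n)) :
    IsSeparableList (List.ofFn fun i => (π i : ℕ)) ↔ ¬ Contains2413 π ∧ ¬ Contains3142 π := by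
  simp only [IsSeparableList, Avoids2413, sublist_ofFn_iff, Contains2413, Contains3142, Fin.lt_def]
  constructor
  · rintro ⟨h₁, h₂⟩
    constructor
    · rintro ⟨i₁, i₂, i₃, i₄, h₁₂, h₂₃, h₃₄, hca, had, hdb⟩
      exact h₁ _ _ _ _ ⟨i₁, i₂, i₃, i₄, h₁₂, h₂₃, h₃₄, rfl, rfl, rfl, rfl⟩ hca had hdb
    · rintro ⟨i₁, i₂, i₃, i₄, h₁₂, h₂₃, h₃₄, hbd, hda, hac⟩
      exact h₂ _ _ _ _ ⟨i₁, i₂, i₃, i₄, h₁₂, h₂₃, h₃₄, rfl, rfl, rfl, rfl⟩ hac hda hbd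
  · rintro ⟨h₁, h₂⟩
    constructor
    · rintro _ _ _ _ ⟨i₁, i₂, i₃, i₄, h₁₂, h₂₃, h₃₄, rfl, rfl, rfl, rfl⟩ hca had hdb
      exact h₁ ⟨i₁, i₂, i₃, i₄, h₁₂, h₂₃, h₃₄, hca, had, hdb⟩
    · rintro _ _ _ _ ⟨i₁, i₂, i₃, i₄, h₁₂, h₂₃, h₃₄, rfl, rfl, rfl, rfl⟩ hac hda hbd
      exact h₂ ⟨i₁, i₂, i₃, i₄, h₁₂, h₂₃, h₃₄, hbd, hda, hac⟩

theorem card_separable_perm (n : ℕ) :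
    Nat.card {π : Equiv.Perm (Fin n) // ¬ Contains2413 π ∧ ¬ Contains3142 π} =
      (separableLists 0 n).card := by
  classical
  rw [Nat.card_eq_fintype_card, Fintype.card_subtype]
  refine Finset.card_bij (fun π _ => List.ofFn fun i => (π i : ℕ)) ?_ ?_ ?_
  · intro π hπ
    rw [Finset.mem_filter] at hπ
    refine mem_separableLists.2 ⟨?_, (isSeparableList_ofFn_iff π).2 hπ.2⟩
    rw [← List.range_eq_range']
    refine (List.perm_ext_iff_of_nodup (List.nodup_ofFn.2 ?_) List.nodup_range).2 fun x => ?_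
    · exact Fin.val_injective.comp π.injective
    · simp only [List.mem_ofFn, List.mem_range]
      exact ⟨fun ⟨i, hi⟩ => hi ▸ (π i).2, fun hx => ⟨π.symm ⟨x, hx⟩, by simp⟩⟩
  · intro π _ σ _ h
    ext i
    exact congrFun (List.ofFn_injective h) i
  · intro l hl
    obtain ⟨hp, hs⟩ := mem_separableLists.1 hl
    obtain rfl : l.length = n := by simpa using hp.length_eq
    have hlt : ∀ i : Fin l.length, l.get i < l.length := fun i => by
      simpa using hp.subset (l.get_mem i)
    have hinj : Function.Injective fun i : Fin l.length => (⟨l.get i, hlt i⟩ : Fin l.length) :=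
      fun i j hij => (hp.nodup_iff.2 List.nodup_range').injective_get (by simpa using hij)
    have hofFn : (List.ofFn fun i =>
        (Equiv.ofBijective _ (Finite.injective_iff_bijective.1 hinj) i : ℕ)) = l :=
      List.ofFn_get l
    refine ⟨Equiv.ofBijective _ (Finite.injective_iff_bijective.1 hinj), ?_, hofFn⟩
    rw [Finset.mem_filter, ← isSeparableList_ofFn_iff, hofFn]
    exact ⟨Finset.mem_univ _, hs⟩

theorem sum_antidiagonal_choose_mul_choose (a b n : ℕ) :
    ∑ p ∈ Finset.HasAntidiagonal.antidiagonal n, p.1.choose a * p.2.choose b = (n + 1).choose (a + b + 1) := by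
  induction n generalizing b with
  | zero =>
    rcases a with _ | a <;> rcases b with _ | b <;> simp [Nat.choose_eq_zero_of_lt]
  | succ n ih =>
    rw [Finset.Nat.antidiagonal_succ', Finset.sum_cons, Finset.sum_map]
    rcases b with _ | b
    · have := ih 0
      simp only [Nat.choose_zero_right, mul_one] at this
      simp [this, Nat.choose_succ_succ (n + 1)]
    · simp [Nat.choose_succ_succ, mul_add, Finset.sum_add_distrib]
      have h1 := ih b
      have h2 := ih (b + 1)
      rw [h1, h2, ← Nat.choose_succ_succ n, add_assoc a b 1]

theorem sum_antidiagonal_choose_add_mul_choose_add (k l m : ℕ) :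
    ∑ p ∈ Finset.HasAntidiagonal.antidiagonal m, (p.1 + k).choose (2 * k) * (p.2 + l).choose (2 * l) =
      (m + k + l + 1).choose (2 * k + 2 * l + 1) := by
  rw [← sum_antidiagonal_choose_mul_choose]
  refine Finset.sum_of_injOn (fun p => (p.1 + k, p.2 + l)) ?_ ?_ ?_ ?_
  · rintro ⟨a, b⟩ - ⟨c, d⟩ - h
    simpa using h
  · rintro ⟨a, b⟩ h
    simp at h ⊢
    omega
  · rintro ⟨a, b⟩ h h'
    simp only [Set.mem_image, Finset.mem_coe, Prod.exists, not_exists, not_and,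
      Finset.HasAntidiagonal.mem_antidiagonal, Prod.mk.injEq, mul_eq_zero] at h h' ⊢
    by_contra! hc
    have ha : 2 * k ≤ a := by
      by_contra hh
      exact hc.1 (Nat.choose_eq_zero_of_lt (by omega))
    have hb : 2 * l ≤ b := by
      by_contra hh
      exact hc.2 (Nat.choose_eq_zero_of_lt (by omega))
    exact h' (a - k) (b - l) (by omega) (by omega) (by omega)
  · simp

theorem sum_choose_mul_catalan_of_lt (n N : ℕ) (h : n < N) :
    ∑ k ∈ Finset.range N, (n + k).choose (2 * k) * catalan k =
      ∑ k ∈ Finset.range (n + 1), (n + k).choose (2 * k) * catalan k := by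
  symm
  apply Finset.sum_subset
  · intro x; simp; omega
  · intro x _ hx
    rw [Nat.choose_eq_zero_of_lt (by simp at hx; omega), zero_mul]

theorem sum_choose_mul_catalan_succ (m : ℕ) :
    ∑ k ∈ Finset.range (m + 2), (m + 1 + k).choose (2 * k) * catalan k =
      ∑ k ∈ Finset.range (m + 1), (m + k).choose (2 * k) * catalan k +
        ∑ p ∈ Finset.HasAntidiagonal.antidiagonal m,
          (∑ k ∈ Finset.range (p.1 + 1), (p.1 + k).choose (2 * k) * catalan k) *
            ∑ k ∈ Finset.range (p.2 + 1), (p.2 + k).choose (2 * k) * catalan k := by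
  have hconv : ∑ p ∈ Finset.HasAntidiagonal.antidiagonal m,
        (∑ k ∈ Finset.range (p.1 + 1), (p.1 + k).choose (2 * k) * catalan k) *
          ∑ k ∈ Finset.range (p.2 + 1), (p.2 + k).choose (2 * k) * catalan k =
      ∑ s ∈ Finset.range (m + 1), (m + s + 1).choose (2 * s + 1) * catalan (s + 1) := by
    calc
      _ = ∑ p ∈ Finset.HasAntidiagonal.antidiagonal m, ∑ k ∈ Finset.range (m + 1), ∑ l ∈ Finset.range (m + 1),
          catalan k * catalan l * ((p.1 + k).choose (2 * k) * (p.2 + l).choose (2 * l)) := by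
        refine Finset.sum_congr rfl fun p hp => ?_
        rw [Finset.HasAntidiagonal.mem_antidiagonal] at hp
        rw [← sum_choose_mul_catalan_of_lt p.1 (m + 1) (by omega),
          ← sum_choose_mul_catalan_of_lt p.2 (m + 1) (by omega), Finset.sum_mul_sum]
        exact Finset.sum_congr rfl fun _ _ => Finset.sum_congr rfl fun _ _ => by ring
      _ = ∑ k ∈ Finset.range (m + 1), ∑ l ∈ Finset.range (m + 1),
          catalan k * catalan l * (m + k + l + 1).choose (2 * k + 2 * l + 1) := by
        rw [Finset.sum_comm]
        refine Finset.sum_congr rfl fun k _ => ?_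
        rw [Finset.sum_comm]
        refine Finset.sum_congr rfl fun l _ => ?_
        rw [← Finset.mul_sum, sum_antidiagonal_choose_add_mul_choose_add]
      _ = ∑ s ∈ Finset.range (m + 1), ∑ p ∈ Finset.HasAntidiagonal.antidiagonal s,
          catalan p.1 * catalan p.2 * (m + s + 1).choose (2 * s + 1) := by
        rw [← Finset.sum_product', Finset.sum_sigma']
        symm
        refine Finset.sum_of_injOn (fun x => x.2) ?_ ?_ ?_ ?_
        · rintro ⟨s, a, b⟩ h ⟨s', a', b'⟩ h' heq
          simp at h h' heq
          obtain ⟨rfl, rfl⟩ := heq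
          obtain ⟨_, rfl⟩ := h
          obtain ⟨_, rfl⟩ := h'
          rfl
        · rintro ⟨s, a, b⟩ h
          simp at h ⊢
          omega
        · rintro ⟨a, b⟩ h h'
          simp at h h' ⊢
          right
          apply Nat.choose_eq_zero_of_lt
          by_contra hc
          omega
        · rintro ⟨s, a, b⟩ h
          simp at h ⊢
          obtain ⟨_, rfl⟩ := h
          left
          congr 1 <;> ring
      _ = _ := by
        refine Finset.sum_congr rfl fun s _ => ?_
        rw [catalan_succ', ← Finset.sum_mul, mul_comm]
  rw [hconv, ← sum_choose_mul_catalan_of_lt m (m + 2) (by omega),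
    Finset.sum_range_succ' _ (m + 1), Finset.sum_range_succ' _ (m + 1)]
  have : ∀ s, (m + 1 + (s + 1)).choose (2 * (s + 1)) =
      (m + (s + 1)).choose (2 * (s + 1)) + (m + s + 1).choose (2 * s + 1) := fun s => by
    rw [show m + 1 + (s + 1) = (m + s + 1) + 1 by ring, show 2 * (s + 1) = (2 * s + 1) + 1 by ring,
      Nat.choose_succ_succ, add_comm, ← add_assoc m]
  simp only [this, add_mul, Finset.sum_add_distrib]
  simp
  ring

theorem largeSchroder_eq_sum_choose_mul_catalan (n : ℕ) :
    n.largeSchroder = ∑ k ∈ Finset.range (n + 1), (n + k).choose (2 * k) * catalan k := by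
  induction n using Nat.strong_induction_on with
  | _ n ih =>
    rcases n with _ | m
    · simp
    · rw [Nat.largeSchroder_succ, sum_choose_mul_catalan_succ, ← ih m (by omega),
        ← Nat.range_succ_eq_Iic, ← Finset.Nat.sum_antidiagonal_eq_sum_range_succ
          (fun i j => i.largeSchroder * j.largeSchroder) m]
      congr 1
      refine Finset.sum_congr rfl fun p hp => ?_
      rw [Finset.HasAntidiagonal.mem_antidiagonal] at hp
      rw [ih p.1 (by omega), ih p.2 (by omega)]

theorem choose_mul_catalan_eq_factorial_div {m k : ℕ} (h : k ≤ m) :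
    (((m + k).choose (2 * k) * catalan k : ℕ) : ℚ) =
      (m + k).factorial / (k.factorial * (k + 1).factorial * (m - k).factorial) := by
  have h1 := Nat.choose_mul_factorial_mul_factorial (n := m + k) (k := 2 * k) (by omega)
  have h2 := Nat.choose_mul_factorial_mul_factorial (n := 2 * k) (k := k) (by omega)
  have h3 := succ_mul_catalan_eq_centralBinom k
  rw [Nat.centralBinom] at h3
  rw [show m + k - 2 * k = m - k by omega] at h1
  rw [show 2 * k - k = k by omega, ← h3] at h2
  rw [eq_div_iff (by positivity)]
  norm_cast
  rw [← h1, ← h2, Nat.factorial_succ]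
  ring

theorem separable_count {n : ℕ} (hn : 1 ≤ n) :
    (Nat.card {π : Equiv.Perm (Fin n) // ¬ Contains2413 π ∧ ¬ Contains3142 π} : ℚ) =
      ∑ k ∈ Finset.range n,
        (Nat.factorial (n - 1 + k) : ℚ) /
          (Nat.factorial k * Nat.factorial (k + 1) * Nat.factorial (n - 1 - k)) := by
  obtain ⟨m, rfl⟩ := Nat.exists_eq_add_of_le' hn
  rw [card_separable_perm, card_separableLists, largeSchroder_eq_sum_choose_mul_catalan,
    Nat.cast_sum, Nat.add_sub_cancel]
  exact Finset.sum_congr rfl fun k hk =>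
    choose_mul_catalan_eq_factorial_div (Nat.lt_succ_iff.1 (Finset.mem_range.1 hk))
end
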